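/- Let k be an algebraically closed field and A a spectroid over k. If f : L → M is an irreducible monomorphism in mod A and L is finitely generated, then the cokernel coker(f) of f is finitely presented. -/

import Mathlib

open CategoryTheory CategoryTheory.Limits

namespace Paper

variable (k : Type) [Field k]

section General

variable (A : Type) [Category.{0} A] [Preadditive A] [CategoryTheory.Linear k A]

/-- A spectroid over `k`: a (small) Hom-finite `k`-linear category in which every object
has a local endomorphism ring and distinct objects are not isomorphic. -/
class Spectroid : Prop where
  homFinite : ∀ a b : A, FiniteDimensional k (a ⟶ b)
  localEnd : ∀ a : A, IsLocalRing (End a)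
  skeletal : ∀ a b : A, (a ≅ b) → a = b

variable {A}

/-- `M` is a module over `A`, i.e. the functor `M : A ⥤ ModuleCat k` is additive and
`k`-linear on morphisms. -/
def IsMod (M : A ⥤ ModuleCat.{0} k) : Prop :=
  (∀ {a b : A} (f g : a ⟶ b), M.map (f + g) = M.map f + M.map g) ∧
  (∀ {a b : A} (r : k) (f : a ⟶ b), M.map (r • f) = r • M.map f)

/-- `M` is a locally finite dimensional module over `A`, i.e. an object of `mod A`. -/
def IsLfdMod (M : A ⥤ ModuleCat.{0} k) : Prop :=
  IsMod k M ∧ ∀ a : A, FiniteDimensional k (M.obj a)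

/-- The projective module `P_a = Hom_A(a, -)` at an object `a`. -/
noncomputable def ProjAt (a : A) : A ⥤ ModuleCat.{0} k :=
  (linearCoyoneda k A).obj (Opposite.op a)

/-- The injective module `I_a = D Hom_A(-, a)` at an object `a`. -/
noncomputable def InjAt (a : A) : A ⥤ ModuleCat.{0} k where
  obj b := ModuleCat.of k (Module.Dual k (b ⟶ a))
  map {b c} f := ModuleCat.ofHom (LinearMap.dualMap (Linear.leftComp k a f))
  map_id b := by
    have h : Linear.leftComp k a (𝟙 b) = LinearMap.id := by
      apply LinearMap.ext; intro g; simp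
    rw [h, LinearMap.dualMap_id]; rfl
  map_comp {b c d} f g := by
    have h : Linear.leftComp k a (f ≫ g) =
        (Linear.leftComp k a f).comp (Linear.leftComp k a g) := by
      apply LinearMap.ext; intro h; simp
    rw [h]; rfl

instance : HasFiniteBiproducts (A ⥤ ModuleCat.{0} k) :=
  CategoryTheory.Abelian.hasFiniteBiproducts

/-- `M` is finitely generated: there is an epimorphism `⊕_{i=1}^r P_{a_i} → M`. -/
def IsFG (M : A ⥤ ModuleCat.{0} k) : Prop :=
  ∃ (r : ℕ) (a : Fin r → A) (f : (⨁ fun i => ProjAt k (a i)) ⟶ M), Epi f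

/-- `M` is finitely presented: there is an epimorphism `⊕_{i=1}^r P_{a_i} → M` with
finitely generated kernel. -/
def IsFP (M : A ⥤ ModuleCat.{0} k) : Prop :=
  ∃ (r : ℕ) (a : Fin r → A) (f : (⨁ fun i => ProjAt k (a i)) ⟶ M),
    Epi f ∧ IsFG k (kernel f)

/-- `M` is finitely co-generated: there is a monomorphism `M → ⊕_{j=1}^s I_{b_j}`. -/
def IsFCG (M : A ⥤ ModuleCat.{0} k) : Prop :=
  ∃ (s : ℕ) (b : Fin s → A) (f : M ⟶ ⨁ fun j => InjAt k (b j)), Mono f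

/-- `M` is finitely co-presented: there is a monomorphism `M → ⊕_{j=1}^s I_{b_j}` with
finitely co-generated cokernel. -/
def IsFCP (M : A ⥤ ModuleCat.{0} k) : Prop :=
  ∃ (s : ℕ) (b : Fin s → A) (f : M ⟶ ⨁ fun j => InjAt k (b j)),
    Mono f ∧ IsFCG k (cokernel f)

/-- `f` is an irreducible morphism in `mod A`: it is neither a split mono nor a split epi,
and in any factorization `f = g ≫ h` through an object of `mod A`, `g` is a split mono
or `h` is a split epi. -/
def Irred {L M : A ⥤ ModuleCat.{0} k} (f : L ⟶ M) : Prop :=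
  ¬ IsSplitMono f ∧ ¬ IsSplitEpi f ∧
    ∀ ⦃X : A ⥤ ModuleCat.{0} k⦄, IsLfdMod k X →
      ∀ (g : L ⟶ X) (h : X ⟶ M), g ≫ h = f → IsSplitMono g ∨ IsSplitEpi h

/-- `M` is an indecomposable object of `mod A`: it is nonzero, and whenever `M ≅ X ⊞ Y`
with `X`, `Y` in `mod A`, one of `X`, `Y` is zero. -/
def Indec (M : A ⥤ ModuleCat.{0} k) : Prop :=
  ¬ IsZero M ∧ ∀ ⦃X Y : A ⥤ ModuleCat.{0} k⦄, IsLfdMod k X → IsLfdMod k Y →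
    (M ≅ X ⊞ Y) → IsZero X ∨ IsZero Y

/-- `0 → L →f M →g N → 0` is an almost split sequence in `mod A`. -/
structure AlmostSplitSeq {L M N : A ⥤ ModuleCat.{0} k} (f : L ⟶ M) (g : M ⟶ N) : Prop where
  mono : Mono f
  epi : Epi g
  zero : f ≫ g = 0
  exact : (ShortComplex.mk f g zero).Exact
  not_splitMono : ¬ IsSplitMono f
  not_splitEpi : ¬ IsSplitEpi g
  left_almost_split : ∀ ⦃X : A ⥤ ModuleCat.{0} k⦄, IsLfdMod k X →
    ∀ u : L ⟶ X, ¬ IsSplitMono u → ∃ v : M ⟶ X, f ≫ v = u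
  right_almost_split : ∀ ⦃X : A ⥤ ModuleCat.{0} k⦄, IsLfdMod k X →
    ∀ u : X ⟶ N, ¬ IsSplitEpi u → ∃ v : X ⟶ M, v ≫ g = u

/-- `M` is projective as an object of `mod A`. -/
def ProjInMod (M : A ⥤ ModuleCat.{0} k) : Prop :=
  ∀ ⦃X Y : A ⥤ ModuleCat.{0} k⦄, IsLfdMod k X → IsLfdMod k Y →
    ∀ (e : X ⟶ Y), Epi e → ∀ u : M ⟶ Y, ∃ t : M ⟶ X, t ≫ e = u

/-- `M` is injective as an object of `mod A`. -/
def InjInMod (M : A ⥤ ModuleCat.{0} k) : Prop :=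
  ∀ ⦃X Y : A ⥤ ModuleCat.{0} k⦄, IsLfdMod k X → IsLfdMod k Y →
    ∀ (m : X ⟶ Y), Mono m → ∀ u : X ⟶ M, ∃ t : Y ⟶ M, m ≫ t = u

/-- `h` is a (nonempty) composition of irreducible morphisms between indecomposable
objects of `mod A`. -/
inductive IrredChain : ∀ {X Y : A ⥤ ModuleCat.{0} k}, (X ⟶ Y) → Prop
  | single {X Y : A ⥤ ModuleCat.{0} k} (f : X ⟶ Y) :
      IsLfdMod k X → Indec k X → IsLfdMod k Y → Indec k Y → Irred k f → IrredChain f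
  | comp {X Y Z : A ⥤ ModuleCat.{0} k} (f : X ⟶ Y) (g : Y ⟶ Z) :
      IsLfdMod k X → Indec k X → Irred k f → IrredChain g → IrredChain (f ≫ g)

end General

section QuiverSection

variable (Q : Type) [Quiver.{0} Q]

/-- `Q` is locally finite: every vertex is the source of finitely many arrows and the
target of finitely many arrows. -/
def LocallyFinite : Prop :=
  ∀ x : Q, Finite (Σ y : Q, x ⟶ y) ∧ Finite (Σ y : Q, y ⟶ x)

/-- `Q` is interval finite: there are finitely many paths between any two vertices. -/
def IntervalFinite : Prop :=
  ∀ x y : Q, Finite (Quiver.Path x y)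

/-- `Q` is strongly locally finite: locally finite and interval finite. -/
def StronglyLocallyFinite : Prop :=
  LocallyFinite Q ∧ IntervalFinite Q

/-- `Q` is connected: nonempty, and any two vertices are joined by a walk. -/
def QuiverConnected : Prop :=
  Nonempty Q ∧ ∀ x y : Q,
    Nonempty (Quiver.Path (Quiver.Symmetrify.of.obj x) (Quiver.Symmetrify.of.obj y))

/-- The path category `kQ` of the quiver `Q`: the free `k`-linear category on the free
category on `Q`. -/
abbrev PathCat := CategoryTheory.Free k (Paths Q)

/-- A vertex of `Q`, seen as an object of the path category `kQ`. -/
noncomputable def vtx (x : Q) : PathCat k Q :=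
  (Free.embedding k (Paths Q)).obj ((Paths.of Q).obj x)

/-- An arrow of `Q`, seen as a morphism of the path category `kQ`. -/
noncomputable def arrHom {x y : Q} (α : x ⟶ y) : vtx k Q x ⟶ vtx k Q y :=
  (Free.embedding k (Paths Q)).map ((Paths.of Q).map α)

/-- The degree of a vertex of `Q`: the total number of arrows incident to it. -/
noncomputable def degree (x : Q) : ℕ :=
  Nat.card ((Σ y : Q, x ⟶ y) ⊕ (Σ y : Q, y ⟶ x))

/-- `M` belongs to `rrep(Q)`: it is the middle term of a short exact sequence
`0 → L → M → N → 0` with `L` finitely presented, `N` finitely co-presented, and only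
finitely many arrows `α` of `Q` satisfy `M(α) ≠ 0`, `L(α) = 0` and `N(α) = 0`. -/
def InRrep (M : PathCat k Q ⥤ ModuleCat.{0} k) : Prop :=
  ∃ (L N : PathCat k Q ⥤ ModuleCat.{0} k) (f : L ⟶ M) (g : M ⟶ N) (zero : f ≫ g = 0),
    Mono f ∧ Epi g ∧ (ShortComplex.mk f g zero).Exact ∧ IsFP k L ∧ IsFCP k N ∧
    Set.Finite {p : Σ (x : Q) (y : Q), x ⟶ y |
      M.map (arrHom k Q p.2.2) ≠ 0 ∧ L.map (arrHom k Q p.2.2) = 0 ∧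
      N.map (arrHom k Q p.2.2) = 0}

variable {Q}

/-- The vertices occurring in a path. -/
def InPath {x : Q} : ∀ {y : Q}, Quiver.Path x y → Q → Prop
  | _, Quiver.Path.nil, v => v = x
  | _, @Quiver.Path.cons _ _ _ _ c p _, v => v = c ∨ InPath p v

variable (Q)

/-- `Q` is a star quiver: it is obtained from a finite full convex subquiver `Γ` by
attaching finitely many rays and co-rays with no common vertices. -/
def IsStarQuiver : Prop :=
  ∃ (Γ S₁ S₂ : Set Q) (v : Q → ℕ → Q),
    Γ.Finite ∧ S₁ ⊆ Γ ∧ S₂ ⊆ Γ ∧ Disjoint S₁ S₂ ∧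
    (∀ x y : Q, x ∈ Γ → y ∈ Γ → ∀ p : Quiver.Path x y, ∀ z : Q, InPath p z → z ∈ Γ) ∧
    (∀ s ∈ S₁ ∪ S₂, ∀ i : ℕ, v s i ∉ Γ) ∧
    (∀ s ∈ S₁ ∪ S₂, ∀ t ∈ S₁ ∪ S₂, ∀ i j : ℕ, v s i = v t j → s = t ∧ i = j) ∧
    (∀ x : Q, x ∉ Γ → ∃ s ∈ S₁ ∪ S₂, ∃ i : ℕ, x = v s i) ∧
    (∀ s ∈ S₁, Nat.card (s ⟶ v s 0) = 1 ∧ ∀ i : ℕ, Nat.card (v s i ⟶ v s (i + 1)) = 1) ∧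
    (∀ s ∈ S₂, Nat.card (v s 0 ⟶ s) = 1 ∧ ∀ i : ℕ, Nat.card (v s (i + 1) ⟶ v s i) = 1) ∧
    (∀ x y : Q, (x ⟶ y) → ¬(x ∈ Γ ∧ y ∈ Γ) →
      (∃ s ∈ S₁, (x = s ∧ y = v s 0) ∨ ∃ i : ℕ, x = v s i ∧ y = v s (i + 1)) ∨
      (∃ s ∈ S₂, (x = v s 0 ∧ y = s) ∨ ∃ i : ℕ, x = v s (i + 1) ∧ y = v s i))

end QuiverSection

section Helpers

variable {k}

/-- A system of linear equations with prescribed values, for an unknown linear functional,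
is solvable as soon as all its finite subsystems are. -/
theorem exists_dual_of_finite {k : Type} [Field k] {V E : Type} [AddCommGroup V] [Module k V]
    (l : E → V) (b : E → k)
    (h : ∀ F : Finset E, ∃ χ : Module.Dual k V, ∀ e ∈ F, χ (l e) = b e) :
    ∃ χ : Module.Dual k V, ∀ e, χ (l e) = b e := by
  have hb : Finsupp.linearCombination k b ∈
      LinearMap.range (Finsupp.linearCombination k l).dualMap := by
    rw [LinearMap.range_dualMap_eq_dualAnnihilator_ker, Submodule.mem_dualAnnihilator]
    intro z hz
    obtain ⟨χ, hχ⟩ := h z.support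
    have h0 := congrArg χ (LinearMap.mem_ker.1 hz)
    rw [map_zero, Finsupp.linearCombination_apply, Finsupp.sum, map_sum] at h0
    rw [Finsupp.linearCombination_apply, Finsupp.sum, ← h0]
    exact Finset.sum_congr rfl fun e he => by rw [map_smul, hχ e he]
  obtain ⟨χ, hχ⟩ := hb
  exact ⟨χ, fun e => by simpa using LinearMap.congr_fun hχ (Finsupp.single e 1)⟩

open DirectSum in
/-- A compactness principle for systems of affine linear equations in finite-dimensional
unknowns: a system all of whose finite subsystems are solvable is solvable. -/
theorem exists_solution_of_finite {k : Type} [Field k] {ι E : Type} [DecidableEq ι] (W : ι → Type)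
    [∀ i, AddCommGroup (W i)] [∀ i, Module k (W i)] [∀ i, FiniteDimensional k (W i)]
    (l : E → ⨁ i, Module.Dual k (W i)) (b : E → k)
    (h : ∀ F : Finset E, ∃ s : ∀ i, W i, ∀ e ∈ F,
      toModule k ι k (fun i => Module.Dual.eval k (W i) (s i)) (l e) = b e) :
    ∃ s : ∀ i, W i, ∀ e,
      toModule k ι k (fun i => Module.Dual.eval k (W i) (s i)) (l e) = b e := by
  obtain ⟨χ, hχ⟩ := exists_dual_of_finite l b fun F => (h F).imp' _ fun s hs => hs
  refine ⟨fun i => (Module.evalEquiv k (W i)).symm (χ.comp (lof k ι (fun i => Module.Dual k (W i)) i)),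
    fun e => ?_⟩
  rw [← hχ e]
  refine LinearMap.congr_fun (DirectSum.linearMap_ext k fun i => LinearMap.ext fun ξ => ?_) (l e)
  rw [LinearMap.comp_apply, toModule_lof, ← Module.evalEquiv_toLinearMap, LinearEquiv.coe_coe,
    LinearEquiv.apply_symm_apply]

theorem lift_of_comp_cokernel {𝒞 : Type*} [Category 𝒞] [Abelian 𝒞] {L M K : 𝒞} (f : L ⟶ M) [Mono f]
    (κ : K ⟶ M) (hκ : κ ≫ cokernel.π f = 0) : ∃ l : K ⟶ L, l ≫ f = κ := by
  have : Mono (ShortComplex.mk f (cokernel.π f) (cokernel.condition f)).f := ‹Mono f›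
  exact ⟨_, (ShortComplex.exact_cokernel f).lift_f κ hκ⟩

theorem exists_lift_of_retraction_pullback {𝒞 : Type*} [Category 𝒞] [Abelian 𝒞] {L M X : 𝒞}
    (f : L ⟶ M) [Mono f] (v : X ⟶ cokernel f) (j : L ⟶ pullback v (cokernel.π f))
    (hj₁ : j ≫ pullback.fst v (cokernel.π f) = 0) (hj₂ : j ≫ pullback.snd v (cokernel.π f) = f)
    (r : SplitMono j) : ∃ t : X ⟶ M, t ≫ cokernel.π f = v := by
  have hκ : (kernel.ι (pullback.fst v (cokernel.π f)) ≫ pullback.snd v (cokernel.π f)) ≫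
      cokernel.π f = 0 := by
    rw [Category.assoc, ← pullback.condition, ← Category.assoc, kernel.condition, zero_comp]
  obtain ⟨l, hl⟩ := lift_of_comp_cokernel f _ hκ
  have hlj : l ≫ j = kernel.ι (pullback.fst v (cokernel.π f)) := by
    apply pullback.hom_ext
    · rw [Category.assoc, hj₁, comp_zero, kernel.condition]
    · rw [Category.assoc, hj₂, hl]
  have hu : kernel.ι (pullback.fst v (cokernel.π f)) ≫
      (pullback.snd v (cokernel.π f) - r.retraction ≫ f) = 0 := by
    rw [← hlj, Category.assoc, Preadditive.comp_sub, hj₂, ← Category.assoc, r.id, Category.id_comp,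
      sub_self, comp_zero]
  refine ⟨Abelian.epiDesc (pullback.fst v (cokernel.π f)) _ hu, ?_⟩
  rw [← cancel_epi (pullback.fst v (cokernel.π f)), ← Category.assoc, Abelian.comp_epiDesc,
    Preadditive.sub_comp, ← pullback.condition, Category.assoc, cokernel.condition, comp_zero,
    sub_zero]

theorem mono_lift_pullback {𝒞 : Type*} [Category 𝒞] [Abelian 𝒞] {X Y Z : 𝒞}
    (v : X ⟶ Z) (g : Y ⟶ Z) : Mono (biprod.lift (pullback.fst v g) (pullback.snd v g)) :=
  ⟨fun p q hpq => pullback.hom_ext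
    (by simpa using congrArg (fun t => t ≫ biprod.fst) hpq)
    (by simpa using congrArg (fun t => t ≫ biprod.snd) hpq)⟩

theorem isSplitMono_of_section_cokernel {𝒞 : Type*} [Category 𝒞] [Abelian 𝒞] {L M : 𝒞}
    (f : L ⟶ M) [Mono f] (σ : cokernel f ⟶ M) (hσ : σ ≫ cokernel.π f = 𝟙 _) :
    IsSplitMono f := by
  have hκ : (𝟙 M - cokernel.π f ≫ σ) ≫ cokernel.π f = 0 := by
    rw [Preadditive.sub_comp, Category.assoc, hσ, Category.comp_id, Category.id_comp, sub_self]
  obtain ⟨l, hl⟩ := lift_of_comp_cokernel f _ hκ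
  refine ⟨⟨l, ?_⟩⟩
  rw [← cancel_mono f, Category.assoc, hl, Preadditive.comp_sub, ← Category.assoc,
    cokernel.condition, zero_comp, sub_zero, Category.comp_id, Category.id_comp]

variable {A : Type} [Category.{0} A]

theorem app_map {M N : A ⥤ ModuleCat.{0} k} (f : M ⟶ N) {a b : A} (h : a ⟶ b) (x : M.obj a) :
    f.app b (M.map h x) = N.map h (f.app a x) :=
  NatTrans.naturality_apply f h x

theorem app_injective {M N : A ⥤ ModuleCat.{0} k} (f : M ⟶ N) [Mono f] (a : A) :
    Function.Injective (f.app a) :=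
  (ModuleCat.mono_iff_injective _).1 inferInstance

theorem app_surjective {M N : A ⥤ ModuleCat.{0} k} (f : M ⟶ N) [Epi f] (a : A) :
    Function.Surjective (f.app a) :=
  (ModuleCat.epi_iff_surjective _).1 inferInstance

theorem exists_app_eq {S : ShortComplex (A ⥤ ModuleCat.{0} k)} (hS : S.Exact) (a : A)
    (y : S.X₂.obj a) (hy : S.g.app a y = 0) : ∃ x : S.X₁.obj a, S.f.app a x = y :=
  (ShortComplex.moduleCat_exact_iff _).1 (hS.map ((evaluation A (ModuleCat.{0} k)).obj a)) y hy

/-- The elements `x t` generate the module `M`. -/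
def Generates {M : A ⥤ ModuleCat.{0} k} {T : Type} [Fintype T] {a : T → A}
    (x : ∀ t, M.obj (a t)) : Prop :=
  ∀ (b : A) (y : M.obj b), ∃ h : ∀ t, a t ⟶ b, y = ∑ t, M.map (h t) (x t)

/-- Let `R ⟶ P ⟶ X ⟶ 0` and `L ⟶ M ⟶ C ⟶ 0` be exact, and let `g : M ⟶ C` factor through
`v : X ⟶ C`. If `R`, `P` and `L` are finitely generated, so is the kernel `K` of `P ⟶ X ⟶ C`. -/
theorem exists_generates_kernel {R P X C L M K : A ⥤ ModuleCat.{0} k}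
    {ρ : R ⟶ P} {p : P ⟶ X} {v : X ⟶ C} {w : M ⟶ X} {f : L ⟶ M} {g : M ⟶ C} {κ : K ⟶ P}
    [Epi p] [Epi g] [Mono κ] (hρp : ρ ≫ p = 0) (hfg : f ≫ g = 0) (hκ : κ ≫ p ≫ v = 0)
    (hw : w ≫ v = g)
    (exP : ∀ (o : A) (y : P.obj o), p.app o y = 0 → ∃ x, ρ.app o x = y)
    (exM : ∀ (o : A) (y : M.obj o), g.app o y = 0 → ∃ x, f.app o x = y)
    (exK : ∀ (o : A) (y : P.obj o), v.app o (p.app o y) = 0 → ∃ x, κ.app o x = y)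
    {T₁ T₂ T₃ : Type} [Fintype T₁] [Fintype T₂] [Fintype T₃] {a : T₁ → A} {c : T₂ → A} {b : T₃ → A}
    {e₁ : ∀ t, P.obj (a t)} {e₂ : ∀ t, L.obj (c t)} {e₃ : ∀ t, R.obj (b t)}
    (h₁ : Generates e₁) (h₂ : Generates e₂) (h₃ : Generates e₃) :
    ∃ el : ∀ t : T₁ ⊕ T₂ ⊕ T₃, K.obj (Sum.elim a (Sum.elim c b) t), Generates el := by
  have hw' : ∀ (o : A) (z : M.obj o), v.app o (w.app o z) = g.app o z :=
    fun o z => congrArg (fun t => t.app o z) hw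
  have hf0 : ∀ (o : A) (z : L.obj o), g.app o (f.app o z) = 0 :=
    fun o z => congrArg (fun t => t.app o z) hfg
  have hρ0 : ∀ (o : A) z, p.app o (ρ.app o z) = 0 :=
    fun o z => congrArg (fun t => t.app o z) hρp
  choose μ hμ using fun t => app_surjective g (a t) (v.app (a t) (p.app (a t) (e₁ t)))
  choose d hd using fun t => app_surjective p (a t) (w.app (a t) (μ t))
  choose e he using fun t => app_surjective p (c t) (w.app (c t) (f.app (c t) (e₂ t)))
  choose κ₁ hκ₁ using fun t => exK (a t) (e₁ t - d t)
    (by rw [map_sub, map_sub, hd, hw', hμ, sub_self])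
  choose κ₂ hκ₂ using fun t => exK (c t) (e t) (by rw [he, hw', hf0])
  choose κ₃ hκ₃ using fun t => exK (b t) (ρ.app (b t) (e₃ t)) (by rw [hρ0, map_zero])
  refine ⟨fun t => match t with
    | .inl i => κ₁ i
    | .inr (.inl i) => κ₂ i
    | .inr (.inr i) => κ₃ i, fun o y => ?_⟩
  have hvY : v.app o (p.app o (κ.app o y)) = 0 := congrArg (fun t => t.app o y) hκ
  obtain ⟨q₁, hq₁⟩ := h₁ o (κ.app o y)
  have hg : g.app o (∑ i, M.map (q₁ i) (μ i)) = 0 := by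
    rw [← hvY, hq₁]
    simp only [map_sum, app_map, hμ]
  obtain ⟨z, hz⟩ := exM o _ hg
  obtain ⟨q₂, hq₂⟩ := h₂ o z
  have hz' : ∑ i, X.map (q₂ i) (w.app (c i) (f.app (c i) (e₂ i))) =
      ∑ i, X.map (q₁ i) (w.app (a i) (μ i)) := by
    have := congrArg (fun t => w.app o t) hz
    dsimp only at this
    rw [hq₂] at this
    simpa only [map_sum, app_map] using this
  have hrest : p.app o (κ.app o y - ∑ i, P.map (q₁ i) (e₁ i - d i) - ∑ i, P.map (q₂ i) (e i)) =
      0 := by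
    rw [hq₁]
    simp only [map_sub, map_sum, app_map, hd, he, Finset.sum_sub_distrib, hz']
    abel
  obtain ⟨u, hu⟩ := exP o _ hrest
  obtain ⟨q₃, rfl⟩ := h₃ o u
  refine ⟨fun t => match t with
    | .inl i => q₁ i
    | .inr (.inl i) => q₂ i
    | .inr (.inr i) => q₃ i, ?_⟩
  apply app_injective κ o
  simp only [map_sum, app_map] at hu
  simp only [Fintype.sum_sum_type, map_add, map_sum]
  have E₁ : ∀ i, κ.app o (K.map (q₁ i) (κ₁ i)) = P.map (q₁ i) (e₁ i - d i) :=
    fun i => by rw [app_map, hκ₁]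
  have E₂ : ∀ i, κ.app o (K.map (q₂ i) (κ₂ i)) = P.map (q₂ i) (e i) :=
    fun i => by rw [app_map, hκ₂]
  have E₃ : ∀ i, κ.app o (K.map (q₃ i) (κ₃ i)) = P.map (q₃ i) (ρ.app (b i) (e₃ i)) :=
    fun i => by rw [app_map, hκ₃]
  refine Eq.trans ?_ (congrArg₂ (· + ·) (Finset.sum_congr rfl fun i _ => (E₁ i).symm)
    (congrArg₂ (· + ·) (Finset.sum_congr rfl fun i _ => (E₂ i).symm)
      (Finset.sum_congr rfl fun i _ => (E₃ i).symm)))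
  rw [hu]
  abel

variable [Preadditive A] [CategoryTheory.Linear k A]

theorem IsLfdMod.of_mono {M N : A ⥤ ModuleCat.{0} k} (f : M ⟶ N) [Mono f] (hN : IsLfdMod k N) :
    IsLfdMod k M := by
  refine ⟨⟨fun {a b} g h => ?_, fun {a b} r g => ?_⟩, fun a => ?_⟩
  · rw [← cancel_mono (f.app b), Preadditive.add_comp]
    simp only [f.naturality, hN.1.1, Preadditive.comp_add]
  · rw [← cancel_mono (f.app b), CategoryTheory.Linear.smul_comp]
    simp only [f.naturality, hN.1.2, CategoryTheory.Linear.comp_smul]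
  · have := hN.2 a
    exact FiniteDimensional.of_injective (f.app a).hom (app_injective f a)

theorem IsLfdMod.of_epi {M N : A ⥤ ModuleCat.{0} k} (f : M ⟶ N) [Epi f] (hM : IsLfdMod k M) :
    IsLfdMod k N := by
  refine ⟨⟨fun {a b} g h => ?_, fun {a b} r g => ?_⟩, fun a => ?_⟩
  · rw [← cancel_epi (f.app a), Preadditive.comp_add]
    simp only [← f.naturality, hM.1.1, Preadditive.add_comp]
  · rw [← cancel_epi (f.app a), CategoryTheory.Linear.comp_smul]
    simp only [← f.naturality, hM.1.2, CategoryTheory.Linear.smul_comp]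
  · have := hM.2 a
    exact FiniteDimensional.of_surjective (f.app a).hom (app_surjective f a)

theorem IsLfdMod.of_jointly_injective {ι : Type} [Finite ι] {M : A ⥤ ModuleCat.{0} k}
    {N : ι → A ⥤ ModuleCat.{0} k} (hN : ∀ i, IsLfdMod k (N i)) (f : ∀ i, M ⟶ N i)
    (hf : ∀ (a : A) (x y : M.obj a), (∀ i, (f i).app a x = (f i).app a y) → x = y) :
    IsLfdMod k M := by
  refine ⟨⟨fun {a b} g h => ?_, fun {a b} r g => ?_⟩, fun a => ?_⟩
  · ext x
    refine hf b _ _ fun i => ?_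
    simp only [app_map, (hN i).1.1, ModuleCat.hom_add, LinearMap.add_apply, map_add]
  · ext x
    refine hf b _ _ fun i => ?_
    simp only [app_map, (hN i).1.2, ModuleCat.hom_smul, LinearMap.smul_apply, map_smul]
  · have := fun i => (hN i).2 a
    exact FiniteDimensional.of_injective (LinearMap.pi fun i => ((f i).app a).hom)
      fun x y hxy => hf a x y fun i => congrFun hxy i

theorem IsLfdMod.biprod {M N : A ⥤ ModuleCat.{0} k} (hM : IsLfdMod k M) (hN : IsLfdMod k N) :
    IsLfdMod k (M ⊞ N) := by
  refine .of_jointly_injective (ι := WalkingPair) (N := fun j => pairFunction M N j)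
    (by rintro (_ | _) <;> assumption)
    (fun j => match j with
      | .left => biprod.fst
      | .right => biprod.snd) fun a x y hxy => ?_
  have key : ∀ z : (M ⊞ N : A ⥤ ModuleCat.{0} k).obj a,
      z = (biprod.inl : M ⟶ M ⊞ N).app a ((biprod.fst : M ⊞ N ⟶ M).app a z) +
        (biprod.inr : N ⟶ M ⊞ N).app a ((biprod.snd : M ⊞ N ⟶ N).app a z) := by
    intro z
    exact congrArg (fun t : (M ⊞ N ⟶ M ⊞ N) => t.app a z) (biprod.total (X := M) (Y := N)).symm
  rw [key x, key y]
  exact congrArg₂ (· + ·) (congrArg _ (hxy .left)) (congrArg _ (hxy .right))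

theorem isLfdMod_projAt [Spectroid k A] (a : A) : IsLfdMod k (ProjAt k a) := by
  refine ⟨⟨fun {b c} f g => ?_, fun {b c} r f => ?_⟩,
    fun b => Spectroid.homFinite (k := k) a b⟩
  · ext x
    exact Preadditive.comp_add _ _ _ x f g
  · ext x
    exact CategoryTheory.Linear.comp_smul _ _ _ x r f

/-- The morphism `⨁ P_{a_i} ⟶ M` given by elements of `M` at the objects `a_i`. -/
noncomputable def ofElements {M : A ⥤ ModuleCat.{0} k} (hM : IsMod k M) {r : ℕ} {a : Fin r → A}
    (x : ∀ i, M.obj (a i)) : (⨁ fun i => ProjAt k (a i)) ⟶ M :=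
  biproduct.desc fun i =>
    { app b := ModuleCat.ofHom
        { toFun h := M.map h (x i)
          map_add' h h' := by simp [hM.1]
          map_smul' c h := by simp [hM.2] }
      naturality b c h := by
        ext t
        exact congrArg (fun g => g (x i)) (M.map_comp (X := a i) (Y := b) t h) }

/-- The canonical generators of `⨁ P_{a_i}`. -/
noncomputable def gen {r : ℕ} (a : Fin r → A) (i : Fin r) :
    (⨁ fun i => ProjAt k (a i) : A ⥤ ModuleCat.{0} k).obj (a i) :=
  (biproduct.ι (fun i => ProjAt k (a i)) i).app (a i) (𝟙 (a i))

theorem ofElements_gen {M : A ⥤ ModuleCat.{0} k} (hM : IsMod k M) {r : ℕ} {a : Fin r → A}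
    (x : ∀ i, M.obj (a i)) (i : Fin r) : (ofElements hM x).app (a i) (gen a i) = x i := by
  have h : biproduct.ι (fun i => ProjAt k (a i)) i ≫ ofElements hM x = _ :=
    biproduct.ι_desc _ _
  have := congrArg (fun t => t.app (a i) (𝟙 (a i))) h
  refine Eq.trans this ?_
  change M.map (𝟙 (a i)) (x i) = x i
  simp

theorem eq_sum_components {r : ℕ} (a : Fin r → A) {b : A}
    (y : (⨁ fun i => ProjAt k (a i) : A ⥤ ModuleCat.{0} k).obj b) :
    y = ∑ i, (biproduct.ι (fun i => ProjAt k (a i)) i).app b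
      ((biproduct.π (fun i => ProjAt k (a i)) i).app b y) := by
  have := congrArg (fun t => t.app b y) (biproduct.total (f := fun i => ProjAt k (a i)))
  simp only [NatTrans.app_sum, ModuleCat.hom_sum, LinearMap.sum_apply] at this
  exact this.symm

theorem exists_eq_sum_gen {r : ℕ} (a : Fin r → A) {b : A}
    (y : (⨁ fun i => ProjAt k (a i) : A ⥤ ModuleCat.{0} k).obj b) :
    ∃ h : ∀ i, a i ⟶ b, y = ∑ i, (⨁ fun i => ProjAt k (a i) : A ⥤ ModuleCat.{0} k).map (h i)
      (gen a i) := by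
  refine ⟨fun i => (biproduct.π (fun i => ProjAt k (a i)) i).app b y,
    (eq_sum_components a y).trans (Finset.sum_congr rfl fun i _ => ?_)⟩
  refine Eq.trans (congrArg _ ?_) (app_map (biproduct.ι (fun i => ProjAt k (a i)) i)
    (a := a i) (b := b) ((biproduct.π (fun i => ProjAt k (a i)) i).app b y) (𝟙 (a i)))
  exact (Category.id_comp (X := a i) _).symm

theorem isLfdMod_biproduct [Spectroid k A] {r : ℕ} (a : Fin r → A) :
    IsLfdMod k (⨁ fun i => ProjAt k (a i) : A ⥤ ModuleCat.{0} k) := by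
  refine .of_jointly_injective (fun i => isLfdMod_projAt (a i))
    (fun i => biproduct.π (fun i => ProjAt k (a i)) i) fun b x y hxy => ?_
  rw [eq_sum_components a x, eq_sum_components a y]
  exact Finset.sum_congr rfl fun i _ => by rw [hxy i]

theorem epi_ofElements {M : A ⥤ ModuleCat.{0} k} (hM : IsMod k M) {r : ℕ} {a : Fin r → A}
    (x : ∀ i, M.obj (a i))
    (hx : Generates x) :
    Epi (ofElements hM x) := by
  have : ∀ b, Epi ((ofElements hM x).app b) := by
    intro b
    rw [ModuleCat.epi_iff_surjective]
    intro y
    obtain ⟨h, rfl⟩ := hx b y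
    refine ⟨∑ i, (⨁ fun i => ProjAt k (a i) : A ⥤ ModuleCat.{0} k).map (h i) (gen a i), ?_⟩
    rw [map_sum]
    exact Finset.sum_congr rfl fun i _ => by rw [app_map, ofElements_gen]
  exact NatTrans.epi_of_epi_app _

theorem IsFG.exists_generators {M : A ⥤ ModuleCat.{0} k} (hM : IsFG k M) :
    ∃ (r : ℕ) (a : Fin r → A) (x : ∀ i, M.obj (a i)), Generates x := by
  obtain ⟨r, a, f, hf⟩ := hM
  refine ⟨r, a, fun i => f.app (a i) (gen a i), fun b y => ?_⟩
  obtain ⟨z, rfl⟩ := app_surjective f b y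
  obtain ⟨h, rfl⟩ := exists_eq_sum_gen a z
  refine ⟨h, ?_⟩
  rw [map_sum]
  exact Finset.sum_congr rfl fun i _ => app_map _ _ _

/-- Any morphism `v : X ⟶ coker f`, for `f` an irreducible monomorphism, either lifts along
the cokernel projection, or the cokernel projection factors through `v`. -/
theorem Irred.lift_or_factor {L M X : A ⥤ ModuleCat.{0} k} {f : L ⟶ M} [Mono f]
    (hM : IsLfdMod k M) (hf : Irred k f) (hX : IsLfdMod k X) (v : X ⟶ cokernel f) :
    (∃ t : X ⟶ M, t ≫ cokernel.π f = v) ∨ ∃ w : M ⟶ X, w ≫ v = cokernel.π f := by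
  have := mono_lift_pullback v (cokernel.π f)
  have hE : IsLfdMod k (pullback v (cokernel.π f)) := .of_mono
    (biprod.lift (pullback.fst v (cokernel.π f)) (pullback.snd v (cokernel.π f))) (hX.biprod hM)
  have hz : (0 : L ⟶ X) ≫ v = f ≫ cokernel.π f := by rw [cokernel.condition, zero_comp]
  obtain ⟨j, hj₁, hj₂⟩ : ∃ j : L ⟶ pullback v (cokernel.π f),
      j ≫ pullback.fst v (cokernel.π f) = 0 ∧ j ≫ pullback.snd v (cokernel.π f) = f :=
    ⟨pullback.lift 0 f hz, pullback.lift_fst _ _ _, pullback.lift_snd _ _ _⟩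
  rcases hf.2.2 hE j (pullback.snd v (cokernel.π f)) hj₂ with ⟨⟨⟨r⟩⟩⟩ | ⟨⟨⟨s⟩⟩⟩
  · exact .inl (exists_lift_of_retraction_pullback f v j hj₁ hj₂ r)
  · refine .inr ⟨s.section_ ≫ pullback.fst v (cokernel.π f), ?_⟩
    rw [Category.assoc, pullback.condition, ← Category.assoc, s.id, Category.id_comp]

theorem Generates.isFG {M : A ⥤ ModuleCat.{0} k} (hM : IsMod k M) {T : Type} [Fintype T]
    {a : T → A} {x : ∀ t, M.obj (a t)} (hx : Generates x) : IsFG k M := by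
  let ε : Fin (Fintype.card T) ≃ T := (Fintype.equivFin T).symm
  refine ⟨Fintype.card T, fun i => a (ε i), ofElements hM fun i => x (ε i),
    epi_ofElements hM _ fun o y => ?_⟩
  obtain ⟨h, hh⟩ := hx o y
  exact ⟨fun i => h (ε i), hh.trans (Equiv.sum_comp ε (fun t => M.map (h t) (x t))).symm⟩

/-- If the cokernel projection `M ⟶ coker f` of a morphism `f : L ⟶ M`, with `L` finitely
generated, factors through a finitely presented module, then `coker f` is finitely presented. -/
theorem isFP_cokernel_of_factor [Spectroid k A] {L M : A ⥤ ModuleCat.{0} k} (f : L ⟶ M)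
    (hLfg : IsFG k L) {m n : ℕ} {a : Fin m → A} {b : Fin n → A}
    (ρ : (⨁ fun i => ProjAt k (b i)) ⟶ (⨁ fun i => ProjAt k (a i)))
    (v : cokernel ρ ⟶ cokernel f) (w : M ⟶ cokernel ρ) (hw : w ≫ v = cokernel.π f) :
    IsFP k (cokernel f) := by
  have hv : Epi v := epi_of_epi_fac hw
  refine ⟨m, a, cokernel.π ρ ≫ v, epi_comp _ _, ?_⟩
  have hK : IsLfdMod k (kernel (cokernel.π ρ ≫ v)) :=
    .of_mono (kernel.ι _) (isLfdMod_biproduct a)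
  obtain ⟨q, c, x, hx⟩ := hLfg.exists_generators
  obtain ⟨el, hel⟩ := exists_generates_kernel (cokernel.condition ρ) (cokernel.condition f)
    (kernel.condition (cokernel.π ρ ≫ v)) hw
    (exists_app_eq (ShortComplex.exact_cokernel ρ)) (exists_app_eq (ShortComplex.exact_cokernel f))
    (exists_app_eq (ShortComplex.exact_kernel (cokernel.π ρ ≫ v)))
    (fun _ => exists_eq_sum_gen a) hx (fun _ => exists_eq_sum_gen b)
  exact hel.isFG hK.1

theorem hom_ext_gen {r : ℕ} {a : Fin r → A} {N : A ⥤ ModuleCat.{0} k}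
    {u v : (⨁ fun i => ProjAt k (a i)) ⟶ N}
    (h : ∀ i, u.app (a i) (gen a i) = v.app (a i) (gen a i)) : u = v := by
  ext b y
  obtain ⟨t, rfl⟩ := exists_eq_sum_gen a y
  simp only [map_sum, app_map, h]

/-- A two-term linear relation `C(h) x + C(h') y = z` between elements of a module `C`. -/
structure LinRel (C : A ⥤ ModuleCat.{0} k) where
  /-- the element `x` -/
  fst : Σ a, C.obj a
  /-- the element `y` -/
  snd : Σ a, C.obj a
  /-- the object at which the relation lives -/
  ob : A
  /-- the coefficient of `x` -/
  h₁ : fst.1 ⟶ ob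
  /-- the coefficient of `y` -/
  h₂ : snd.1 ⟶ ob

/-- The element `z` of a relation `C(h) x + C(h') y = z`. -/
noncomputable abbrev LinRel.target {C : A ⥤ ModuleCat.{0} k} (r : LinRel C) : Σ a, C.obj a :=
  ⟨r.ob, C.map r.h₁ r.fst.2 + C.map r.h₂ r.snd.2⟩

theorem exists_finite_lift [Spectroid k A] {M C : A ⥤ ModuleCat.{0} k} (hC : IsMod k C)
    (g : M ⟶ C)
    (H : ∀ {m n : ℕ} {a : Fin m → A} {b : Fin n → A}
      (ρ : (⨁ fun i => ProjAt k (b i)) ⟶ (⨁ fun i => ProjAt k (a i)))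
      (v : cokernel ρ ⟶ C), ∃ t : cokernel ρ ⟶ M, t ≫ g = v)
    (S : Set (Σ a, C.obj a)) (hS : S.Finite) (R : Set (LinRel C)) (hR : R.Finite) :
    ∃ s : ∀ i : (Σ a, C.obj a), M.obj i.1, (∀ i ∈ S, g.app i.1 (s i) = i.2) ∧
      ∀ r ∈ R, s r.target = M.map r.h₁ (s r.fst) + M.map r.h₂ (s r.snd) := by
  classical
  obtain ⟨J, hJfin, hSJ, hRJ⟩ : ∃ J : Set (Σ a, C.obj a), J.Finite ∧ S ⊆ J ∧
      ∀ r ∈ R, r.fst ∈ J ∧ r.snd ∈ J ∧ r.target ∈ J :=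
    ⟨S ∪ (LinRel.fst '' R ∪ (LinRel.snd '' R ∪ LinRel.target '' R)),
      hS.union ((hR.image _).union ((hR.image _).union (hR.image _))), fun _ hi => .inl hi,
      fun r hr => ⟨.inr (.inl ⟨r, hr, rfl⟩), .inr (.inr (.inl ⟨r, hr, rfl⟩)),
        .inr (.inr (.inr ⟨r, hr, rfl⟩))⟩⟩
  obtain ⟨m, c, -, hc⟩ := hJfin.fin_param
  obtain ⟨n, d, -, rfl⟩ := hR.fin_param
  have hP := isLfdMod_biproduct (k := k) fun t => (c t).1
  let q : (⨁ fun t => ProjAt k (c t).1) ⟶ C := ofElements hC fun t => (c t).2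
  have hx' : ∀ i : (Σ a, C.obj a), ∃ y : (⨁ fun t => ProjAt k (c t).1 : A ⥤ _).obj i.1,
      i ∈ J → q.app i.1 y = i.2 := by
    intro i
    by_cases hi : i ∈ J
    · rw [← hc] at hi
      obtain ⟨t, rfl⟩ := hi
      exact ⟨gen _ t, fun _ => ofElements_gen hC _ t⟩
    · exact ⟨0, fun h => absurd h hi⟩
  choose x hx using hx'
  let ρ : (⨁ fun t => ProjAt k (d t).ob) ⟶ (⨁ fun t => ProjAt k (c t).1) :=
    ofElements hP.1 fun t => x (d t).target -
      ((⨁ fun t => ProjAt k (c t).1 : A ⥤ _).map (d t).h₁ (x (d t).fst) +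
        (⨁ fun t => ProjAt k (c t).1 : A ⥤ _).map (d t).h₂ (x (d t).snd))
  have hρ : ∀ t, ρ.app (d t).ob (gen _ t) = x (d t).target -
      ((⨁ fun t => ProjAt k (c t).1 : A ⥤ _).map (d t).h₁ (x (d t).fst) +
        (⨁ fun t => ProjAt k (c t).1 : A ⥤ _).map (d t).h₂ (x (d t).snd)) :=
    fun t => ofElements_gen hP.1 _ t
  clear_value q ρ
  have hρq : ρ ≫ q = 0 := by
    refine hom_ext_gen fun t => ?_
    obtain ⟨h1, h2, h3⟩ := hRJ (d t) ⟨t, rfl⟩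
    have hq : q.app (d t).ob (x (d t).target) =
        C.map (d t).h₁ (d t).fst.2 + C.map (d t).h₂ (d t).snd.2 := hx _ h3
    change q.app (d t).ob (ρ.app (d t).ob (gen _ t)) = 0
    rw [hρ, map_sub, map_add, app_map, app_map, hx _ h1, hx _ h2, hq, sub_self]
  obtain ⟨τ, hτ⟩ := H ρ (cokernel.desc ρ q hρq)
  have hpt : (cokernel.π ρ ≫ τ) ≫ g = q := by
    rw [Category.assoc, hτ, cokernel.π_desc]
  have hρt : ρ ≫ cokernel.π ρ ≫ τ = 0 := by
    rw [← Category.assoc, cokernel.condition, zero_comp]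
  generalize cokernel.π ρ ≫ τ = π at hpt hρt
  refine ⟨fun i => π.app i.1 (x i), fun i hi => ?_, ?_⟩
  · rw [← hx i (hSJ hi), ← hpt]
    rfl
  · rintro _ ⟨t, rfl⟩
    have h0 : π.app (d t).ob (ρ.app (d t).ob (gen _ t)) = 0 :=
      congrArg (fun u => u.app (d t).ob (gen _ t)) hρt
    rw [hρ, map_sub, map_add, app_map, app_map] at h0
    exact sub_eq_zero.1 h0

open DirectSum in
theorem exists_compatible_lift [Spectroid k A] {M C : A ⥤ ModuleCat.{0} k} (hM : IsLfdMod k M)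
    (hC : IsMod k C) (g : M ⟶ C)
    (H : ∀ {m n : ℕ} {a : Fin m → A} {b : Fin n → A}
      (ρ : (⨁ fun i => ProjAt k (b i)) ⟶ (⨁ fun i => ProjAt k (a i)))
      (v : cokernel ρ ⟶ C), ∃ t : cokernel ρ ⟶ M, t ≫ g = v) :
    ∃ s : ∀ i : (Σ a, C.obj a), M.obj i.1, (∀ i, g.app i.1 (s i) = i.2) ∧
      ∀ r : LinRel C, s r.target = M.map r.h₁ (s r.fst) + M.map r.h₂ (s r.snd) := by
  classical
  have := hM.2
  let W : (Σ a, C.obj a) → Type := fun i => M.obj i.1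
  let E := (Σ i : (Σ a, C.obj a), Module.Dual k (C.obj i.1)) ⊕
    (Σ r : LinRel C, Module.Dual k (M.obj r.ob))
  let δ : ∀ i, Module.Dual k (W i) → ⨁ i, Module.Dual k (W i) :=
    fun i => lof k _ (fun i => Module.Dual k (W i)) i
  let l : E → ⨁ i, Module.Dual k (W i) := fun e => match e with
    | .inl ⟨i, η⟩ => δ i (η ∘ₗ (g.app i.1).hom)
    | .inr ⟨r, ξ⟩ => δ r.target ξ -
        (δ r.fst (ξ ∘ₗ (M.map r.h₁).hom) + δ r.snd (ξ ∘ₗ (M.map r.h₂).hom))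
  let b : E → k := fun e => match e with
    | .inl ⟨i, η⟩ => η i.2
    | .inr _ => 0
  have hδ : ∀ (s : ∀ i, W i) (i) (ξ : Module.Dual k (W i)),
      toModule k _ k (fun i => Module.Dual.eval k (W i) (s i)) (δ i ξ) = ξ (s i) :=
    fun s i ξ => toModule_lof _ _ _
  have hl₁ : ∀ (s : ∀ i, W i) i η,
      toModule k _ k (fun i => Module.Dual.eval k (W i) (s i)) (l (.inl ⟨i, η⟩)) =
        η (g.app i.1 (s i)) := fun s i η => hδ s i _
  have hl₂ : ∀ (s : ∀ i : (Σ a, C.obj a), M.obj i.1) (r) (ξ : Module.Dual k (M.obj r.ob)),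
      toModule k _ k (fun i => Module.Dual.eval k (W i) (s i)) (l (.inr ⟨r, ξ⟩)) =
        ξ (s r.target - (M.map r.h₁ (s r.fst) + M.map r.h₂ (s r.snd))) := by
    intro s r ξ
    have h1 := hδ s r.target ξ
    have h2 := hδ s r.fst (ξ ∘ₗ (M.map r.h₁).hom)
    have h3 := hδ s r.snd (ξ ∘ₗ (M.map r.h₂).hom)
    simp only [l, map_sub, map_add]
    exact congrArg₂ (· - ·) h1 (congrArg₂ (· + ·) h2 h3)
  have hb₁ : ∀ i η, b (.inl ⟨i, η⟩) = η i.2 := fun _ _ => rfl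
  have hb₂ : ∀ r, b (.inr r) = 0 := fun _ => rfl
  clear_value l b
  obtain ⟨s, hs⟩ := exists_solution_of_finite W l b fun F => by
    obtain ⟨s, hs₁, hs₂⟩ := exists_finite_lift hC g H
      {i | ∃ η, (.inl ⟨i, η⟩ : E) ∈ F}
      (((F.finite_toSet.preimage Sum.inl_injective.injOn).image Sigma.fst).subset
        (by rintro i ⟨η, h⟩; exact ⟨⟨i, η⟩, h, rfl⟩))
      {r | ∃ ξ, (.inr ⟨r, ξ⟩ : E) ∈ F}
      (((F.finite_toSet.preimage Sum.inr_injective.injOn).image Sigma.fst).subset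
        (by rintro i ⟨η, h⟩; exact ⟨⟨i, η⟩, h, rfl⟩))
    refine ⟨s, ?_⟩
    rintro (⟨i, η⟩ | ⟨r, ξ⟩) he
    · rw [hl₁, hs₁ i ⟨η, he⟩, hb₁]
    · rw [hl₂, hs₂ r ⟨ξ, he⟩, sub_self, map_zero, hb₂]
  refine ⟨s, fun i => ?_, fun r => ?_⟩
  · refine sub_eq_zero.1 ((Module.forall_dual_apply_eq_zero_iff k _).1 fun η => ?_)
    rw [map_sub]
    exact sub_eq_zero.2 ((hl₁ s i η).symm.trans ((hs (.inl ⟨i, η⟩)).trans (hb₁ i η)))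
  · refine sub_eq_zero.1 ((Module.forall_dual_apply_eq_zero_iff k _).1 fun ξ => ?_)
    exact (hl₂ s r ξ).symm.trans ((hs (.inr ⟨r, ξ⟩)).trans (hb₂ _))

/-- An epimorphism `g : M ⟶ C` with `M` locally finite dimensional splits as soon as it is pure,
that is, as soon as all morphisms from finitely presented modules to `C` lift to `M`. -/
theorem exists_section_of_lifts [Spectroid k A] {M C : A ⥤ ModuleCat.{0} k} (hM : IsLfdMod k M)
    (hC : IsMod k C) (g : M ⟶ C)
    (H : ∀ {m n : ℕ} {a : Fin m → A} {b : Fin n → A}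
      (ρ : (⨁ fun i => ProjAt k (b i)) ⟶ (⨁ fun i => ProjAt k (a i)))
      (v : cokernel ρ ⟶ C), ∃ t : cokernel ρ ⟶ M, t ≫ g = v) :
    ∃ σ : C ⟶ M, σ ≫ g = 𝟙 C := by
  obtain ⟨s, hsg, hs⟩ := exists_compatible_lift hM hC g H
  have hsr : ∀ {a a' o : A} (h : a ⟶ o) (h' : a' ⟶ o) (x : C.obj a) (x' : C.obj a') (y : C.obj o),
      y = C.map h x + C.map h' x' →
        s ⟨o, y⟩ = M.map h (s ⟨a, x⟩) + M.map h' (s ⟨a', x'⟩) := by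
    rintro a a' o h h' x x' _ rfl
    exact hs ⟨⟨a, x⟩, ⟨a', x'⟩, o, h, h'⟩
  have hC0 : ∀ a b : A, C.map (0 : a ⟶ b) = 0 := fun a b => by
    simpa using hC.2 (0 : k) (0 : a ⟶ b)
  have hM0 : ∀ a b : A, M.map (0 : a ⟶ b) = 0 := fun a b => by
    simpa using hM.1.2 (0 : k) (0 : a ⟶ b)
  let σ : C ⟶ M :=
    { app a := ModuleCat.ofHom
        { toFun x := s ⟨a, x⟩
          map_add' x y := by
            rw [hsr (𝟙 a) (𝟙 a) x y (x + y) (by simp)]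
            simp
          map_smul' c x := by
            rw [hsr (c • 𝟙 a) (0 : a ⟶ a) x x (c • x) (by simp [hC.2, hC0])]
            simp [hM.1.2, hM0] }
      naturality a o h := by
        ext x
        refine (hsr h (0 : o ⟶ o) x 0 (C.map h x) (by simp)).trans ?_
        rw [hM0]
        exact add_zero _ }
  exact ⟨σ, by ext a x; exact hsg ⟨a, x⟩⟩

end Helpers

variable (k : Type) [Field k] [IsAlgClosed k]
variable (A : Type) [Category.{0} A] [Preadditive A] [CategoryTheory.Linear k A]

/-- If `f : L ⟶ M` is an irreducible monomorphism in `mod A` and `L` is finitely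
generated, then `coker f` is finitely presented. -/
theorem statement_5 [Spectroid k A] {L M : A ⥤ ModuleCat.{0} k}
    (hL : IsLfdMod k L) (hM : IsLfdMod k M) (f : L ⟶ M) (hmono : Mono f)
    (hirr : Irred k f) (hLfg : IsFG k L) :
    IsFP k (cokernel f) := by
  by_contra hC
  have hCl : IsLfdMod k (cokernel f) := .of_epi (cokernel.π f) hM
  obtain ⟨σ, hσ⟩ := exists_section_of_lifts hM hCl.1 (cokernel.π f) fun {m n a b} ρ v => by
    rcases hirr.lift_or_factor hM (.of_epi (cokernel.π ρ) (isLfdMod_biproduct a)) v with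
      h | ⟨w, hw⟩
    · exact h
    · exact absurd (isFP_cokernel_of_factor f hLfg ρ v w hw) hC
  exact hirr.1 (isSplitMono_of_section_cokernel f σ hσ)

end Paper
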